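/- Let 𝒜 be a finite set of complex numbers and let b be a biinfinite sequence with entries in 𝒜. If for every 𝔞 ∈ 𝒜 the constant biinfinite sequence with all entries equal to 𝔞 belongs to X_b, the closure of the shift orbit of b, then the closure of the numerical range of A_b equals the convex hull of its spectrum: closure(W(A_b)) = conv(σ(A_b)). -/

import Mathlib

open scoped ComplexConjugate ENNReal
open Filter

noncomputable section

/-- `ℓ²(ℤ)`, the Hilbert space of square-summable biinfinite complex sequences. -/
abbrev Hseq : Type := lp (fun _ : ℤ => ℂ) 2

/-- `A` is the (bounded) tridiagonal operator `A_b` associated to the biinfinite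
sequence `b`, i.e. `(A x) j = x (j+1) + b (j-1) * x (j-1)`. -/
def IsTridiag (b : ℤ → ℂ) (A : Hseq →L[ℂ] Hseq) : Prop :=
  ∀ x : Hseq, ∀ j : ℤ,
    (A x : ℤ → ℂ) j = (x : ℤ → ℂ) (j + 1) + b (j - 1) * (x : ℤ → ℂ) (j - 1)

/-- The numerical range `W(A) = {⟨Ax, x⟩ : ‖x‖ = 1}`, where
`⟨u, v⟩ = ∑ₖ uₖ · conj(vₖ)`; in Mathlib's convention this is `⟪x, A x⟫_ℂ`. -/
def numRange (A : Hseq →L[ℂ] Hseq) : Set ℂ :=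
  {z | ∃ x : Hseq, ‖x‖ = 1 ∧ (inner (𝕜 := ℂ) x (A x) : ℂ) = z}

/-- The shift orbit `Orb(b) = {φⁿ(b) : n ∈ ℤ}` where `(φⁿ(b))ᵢ = b_{i+n}`. -/
def shiftOrbit (b : ℤ → ℂ) : Set (ℤ → ℂ) :=
  {c | ∃ n : ℤ, c = fun i => b (i + n)}

lemma aux_isCompact_convexHull {s : Set ℂ} (hs : IsCompact s) : IsCompact (convexHull ℝ s) := by
  have key : convexHull ℝ s = ⋃ n ∈ Finset.range 4,
      (fun p : (Fin n → ℝ) × (Fin n → ℂ) => ∑ i, p.1 i • p.2 i) ''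
        (stdSimplex ℝ (Fin n) ×ˢ Set.univ.pi (fun _ => s)) := by
    apply Set.Subset.antisymm
    · intro x hx
      obtain ⟨ι, hι, z, w, hz, haff, hw, hw1, hx⟩ := eq_pos_convex_span_of_mem_convexHull hx
      have hcard : Fintype.card ι ≤ 3 := by
        have := haff.card_le_finrank_succ
        have h2 : Module.finrank ℝ (vectorSpan ℝ (Set.range z)) ≤ 2 := by
          have := Submodule.finrank_le (vectorSpan ℝ (Set.range z))
          rwa [Complex.finrank_real_complex] at this
        omega
      let e := (Fintype.equivFin ι).symm
      refine Set.mem_biUnion (x := Fintype.card ι) (by simp; omega) ?_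
      refine ⟨(fun i => w (e i), fun i => z (e i)), ⟨⟨fun i => (hw _).le, ?_⟩, ?_⟩, ?_⟩
      · rw [← hw1]; exact e.sum_comp w
      · intro i _; exact hz ⟨_, rfl⟩
      · rw [← hx]; exact e.sum_comp (fun i => w i • z i)
    · refine Set.iUnion₂_subset ?_
      rintro n _ _ ⟨⟨w, z⟩, ⟨hw, hz⟩, rfl⟩
      exact (convex_convexHull ℝ s).sum_mem (fun i _ => hw.1 i) hw.2
        (fun i _ => subset_convexHull ℝ s (hz i trivial))
  rw [key]
  refine (Finset.range 4).isCompact_biUnion fun n _ => ?_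
  refine ((isCompact_stdSimplex ℝ (Fin n)).prod (isCompact_univ_pi fun _ => hs)).image ?_
  fun_prop

lemma aux_phase (c : ℂ) : ∃ u : ℂ, ‖u‖ = 1 ∧ c * u = (‖c‖ : ℂ) := by
  by_cases hc : c = 0
  · exact ⟨1, by simp, by simp [hc]⟩
  · have hn : (‖c‖ : ℂ) ≠ 0 := by simpa using hc
    refine ⟨conj c / ‖c‖, ?_, ?_⟩
    · simp [hc]
    · rw [← mul_div_assoc, Complex.mul_conj, Complex.normSq_eq_norm_sq]
      push_cast
      field_simp

/-- Toeplitz–Hausdorff. -/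
lemma aux_convex (A : Hseq →L[ℂ] Hseq) : Convex ℝ (numRange A) := by
  rw [convex_iff_segment_subset]
  rintro p ⟨x, hx, hp⟩ q ⟨y, hy, hq⟩ z hz
  by_cases hpq : p = q
  · subst hpq
    rw [segment_same] at hz
    rw [Set.mem_singleton_iff] at hz
    exact ⟨x, hx, by rw [hz, hp]⟩
  have hqp : q - p ≠ 0 := sub_ne_zero.mpr (Ne.symm hpq)
  rw [segment_eq_image'] at hz
  obtain ⟨s, ⟨hs0, hs1⟩, rfl⟩ := hz
  set B : Hseq → Hseq := fun v => (q - p)⁻¹ • (A v - p • v) with hB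
  have Badd : ∀ v w, B (v + w) = B v + B w := by
    intro v w; simp only [hB, map_add, smul_add, smul_sub]; abel
  have Bsmul : ∀ (c : ℂ) v, B (c • v) = c • B v := by
    intro c v; simp only [hB, map_smul, smul_sub, smul_smul]; simp only [mul_comm, mul_left_comm]
  have hBin : ∀ v, inner ℂ v (B v) = (q - p)⁻¹ * (inner ℂ v (A v) - p * (‖v‖ : ℂ) ^ 2) := by
    intro v
    simp only [hB, inner_smul_right, inner_sub_right, inner_self_eq_norm_sq_to_K]
    rfl
  have Qx : inner ℂ x (B x) = 0 := by rw [hBin, hp, hx]; simp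
  have Qy : inner ℂ y (B y) = 1 := by rw [hBin, hq, hy]; simp [hqp]
  obtain ⟨c, hc, hcu⟩ := aux_phase (inner ℂ y (B x) - conj (inner ℂ x (B y)))
  set r : ℝ := (conj c * inner ℂ x (B y) + c * inner ℂ y (B x)).re with hr
  have hreal : conj c * inner ℂ x (B y) + c * inner ℂ y (B x) = (r : ℂ) := by
    apply Complex.ext
    · simp [hr]
    · have := congrArg Complex.im hcu
      simp only [Complex.ofReal_im, Complex.mul_im, Complex.add_im, Complex.conj_re,
        Complex.conj_im, Complex.sub_re, Complex.sub_im] at this ⊢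
      linarith
  have hcc : conj c * c = 1 := by
    rw [mul_comm, Complex.mul_conj, Complex.normSq_eq_norm_sq, hc]; simp
  let v : ℝ → Hseq := fun t => ((1 - t : ℝ) : ℂ) • (c • x) + (t : ℂ) • y
  have hQv : ∀ t : ℝ, inner ℂ (v t) (B (v t)) = ((t ^ 2 + t * (1 - t) * r : ℝ) : ℂ) := by
    intro t
    simp only [v, Badd, Bsmul, inner_add_left, inner_add_right, inner_smul_left, inner_smul_right,
      Qx, Qy, Complex.conj_ofReal]
    push_cast
    rw [← hreal]
    ring
  have hvc : Continuous v := by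
    have h1 : Continuous fun t : ℝ => ((1 - t : ℝ) : ℂ) := by fun_prop
    have h2 : Continuous fun t : ℝ => (t : ℂ) := by fun_prop
    exact (h1.smul continuous_const).add (h2.smul continuous_const)
  have hv0 : ‖v 0‖ = 1 := by
    have : v 0 = c • x := by
      change ((1 - 0 : ℝ) : ℂ) • (c • x) + ((0 : ℝ) : ℂ) • y = c • x
      rw [Complex.ofReal_zero, zero_smul ℂ y, sub_zero, Complex.ofReal_one, one_smul, add_zero]
    rw [this, norm_smul, hc, hx, mul_one]
  have hv1 : ‖v 1‖ = 1 := by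
    have : v 1 = y := by
      change ((1 - 1 : ℝ) : ℂ) • (c • x) + ((1 : ℝ) : ℂ) • y = y
      rw [sub_self, Complex.ofReal_zero, zero_smul ℂ (c • x), Complex.ofReal_one, one_smul,
        zero_add]
    rw [this, hy]
  let f : ℝ → ℝ := fun t => t ^ 2 + t * (1 - t) * r - s * ‖v t‖ ^ 2
  have hf : Continuous f := by fun_prop
  have hivt := intermediate_value_Icc (zero_le_one' ℝ) hf.continuousOn
  have h0 : (0 : ℝ) ∈ Set.Icc (f 0) (f 1) := by
    simp only [f, hv0, hv1]; constructor <;> norm_num <;> linarith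
  obtain ⟨t, ⟨ht0, ht1⟩, hft⟩ := hivt h0
  have hvt : v t ≠ 0 := by
    intro h
    have h1 : ((1 - t : ℝ) : ℂ) • (c • x) = -((t : ℂ) • y) := eq_neg_of_add_eq_zero_left h
    have h2 := congrArg norm h1
    rw [norm_neg, norm_smul, norm_smul, norm_smul, hc, hx, hy, Complex.norm_real,
      Complex.norm_real, Real.norm_of_nonneg (by linarith), Real.norm_of_nonneg ht0] at h2
    have ht : t ≠ 0 := by intro h; rw [h] at h2; norm_num at h2
    have h3 : (1 - t : ℝ) = t := by linarith
    rw [h3] at h1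
    have h4 : c • x = - y := by
      have htc : (t : ℂ) ≠ 0 := by exact_mod_cast ht
      rw [← smul_neg] at h1
      exact smul_right_injective _ htc h1
    have h5 : inner ℂ (c • x) (B (c • x)) = 0 := by
      rw [Bsmul, inner_smul_left, inner_smul_right, Qx]; simp
    rw [h4] at h5
    have h6 : -y = (-1 : ℂ) • y := by simp
    rw [h6, Bsmul, inner_smul_left, inner_smul_right, Qy] at h5
    simp at h5
  have hn : (‖v t‖ : ℂ) ≠ 0 := by simpa using hvt
  have hval : inner ℂ (v t) (A (v t)) = (p + s * (q - p)) * (‖v t‖ : ℂ) ^ 2 := by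
    have h1 := hQv t
    have h2 : t ^ 2 + t * (1 - t) * r = s * ‖v t‖ ^ 2 := by
      simp only [f] at hft; linarith
    rw [h2, hBin] at h1
    push_cast at h1
    field_simp at h1
    linear_combination h1
  refine ⟨((‖v t‖ : ℂ)⁻¹) • v t, ?_, ?_⟩
  · rw [norm_smul]; simp [hvt]
  · rw [map_smul, inner_smul_left, inner_smul_right, hval]
    simp only [map_inv₀, Complex.conj_ofReal, Complex.real_smul]
    field_simp

lemma aux_spectrum_subset (A : Hseq →L[ℂ] Hseq) : spectrum ℂ A ⊆ closure (numRange A) := by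
  intro z hz
  by_contra hcl
  rw [Metric.mem_closure_iff] at hcl
  push Not at hcl
  obtain ⟨ε, hε, h⟩ := hcl
  apply hz
  refine ContinuousLinearMap.isUnit_of_forall_le_norm_inner_map (𝕜 := ℂ) _
    (c := ⟨ε, hε.le⟩) hε ?_
  intro x
  by_cases hx : x = 0
  · simp [hx]
  have hn : (‖x‖ : ℂ) ≠ 0 := by simpa using hx
  have h1 := h (inner ℂ (((‖x‖ : ℂ)⁻¹) • x) (A (((‖x‖ : ℂ)⁻¹) • x)))
    ⟨_, by rw [norm_smul]; simp [hx], rfl⟩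
  rw [map_smul, inner_smul_left, inner_smul_right, dist_eq_norm] at h1
  rw [norm_inner_symm]
  have h2 : inner ℂ x ((algebraMap ℂ (Hseq →L[ℂ] Hseq) z - A) x)
      = (‖x‖ : ℂ) ^ 2 * (z - (starRingEnd ℂ) ((‖x‖ : ℂ)⁻¹) * ((‖x‖ : ℂ)⁻¹ * inner ℂ x (A x))) := by
    have : (algebraMap ℂ (Hseq →L[ℂ] Hseq) z - A) x = z • x - A x := by
      simp [Algebra.algebraMap_eq_smul_one]
    rw [this, inner_sub_right, inner_smul_right, inner_self_eq_norm_sq_to_K]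
    simp only [map_inv₀, Complex.conj_ofReal]
    have e : ((‖x‖ : ℝ) : ℂ) = (RCLike.ofReal ‖x‖ : ℂ) := rfl
    rw [← e]
    field_simp
  rw [h2, norm_mul, norm_pow, Complex.norm_real, norm_norm]
  exact mul_le_mul_of_nonneg_left h1 (by positivity)

lemma aux_bound (b : ℤ → ℂ) (A : Hseq →L[ℂ] Hseq) (hA : IsTridiag b A) (ω : ℂ) (M : ℝ)
    (hM : ∀ i, ‖ω + conj (ω * b i)‖ ≤ M) (C : ℝ) (hC : ∀ i, ‖b i‖ ≤ C) (x : Hseq) :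
    (ω * inner ℂ x (A x)).re ≤ M * ‖x‖ ^ 2 := by
  have hsq : HasSum (fun j => ‖x j‖ ^ 2) (‖x‖ ^ 2) := by
    have := lp.hasSum_norm (p := 2) (by norm_num) x
    simpa using this
  have hsq' : HasSum (fun j => ‖x (j + 1)‖ ^ 2) (‖x‖ ^ 2) :=
    (Equiv.addRight (1 : ℤ)).hasSum_iff.mpr hsq
  have hs : Summable fun j => ‖x j‖ * ‖x (j + 1)‖ := by
    refine Summable.of_nonneg_of_le (fun j => by positivity) (fun j => ?_)
      (hsq.summable.add hsq'.summable)
    nlinarith [sq_nonneg (‖x j‖ - ‖x (j + 1)‖), sq_nonneg (‖x j‖), sq_nonneg (‖x (j+1)‖)]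
  have hg : Summable fun j => conj (x j) * x (j + 1) := by
    refine Summable.of_norm_bounded hs fun j => ?_
    simp
  have hh : Summable fun j => b j * x j * conj (x (j + 1)) := by
    refine Summable.of_norm_bounded (hs.mul_left C) fun j => ?_
    rw [norm_mul, norm_mul, RCLike.norm_conj, mul_assoc]
    exact mul_le_mul_of_nonneg_right (hC j) (by positivity)
  have hin : HasSum (fun j => conj (x j) * x (j + 1) + b (j - 1) * x (j - 1) * conj (x j))
      (inner ℂ x (A x)) := by
    refine (lp.hasSum_inner (𝕜 := ℂ) x (A x)).congr_fun ?_
    intro j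
    rw [hA x j, RCLike.inner_apply]
    ring
  have hh' : HasSum (fun j => b (j - 1) * x (j - 1) * conj (x j))
      (∑' j, b j * x j * conj (x (j + 1))) := by
    rw [← (Equiv.addRight (1 : ℤ)).hasSum_iff]
    convert hh.hasSum using 1
    ext j
    simp
  have heq : inner ℂ x (A x) = (∑' j, conj (x j) * x (j + 1)) +
      (∑' j, b j * x j * conj (x (j + 1))) := hin.unique (hg.hasSum.add hh')
  have hF : HasSum (fun j => (ω * (conj (x j) * x (j + 1) + b j * x j * conj (x (j + 1)))).re)
      (ω * inner ℂ x (A x)).re := by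
    rw [heq]
    exact Complex.hasSum_re ((hg.hasSum.add hh.hasSum).mul_left ω)
  have hG : HasSum (fun j => M * ((‖x j‖ ^ 2 + ‖x (j + 1)‖ ^ 2) / 2)) (M * ‖x‖ ^ 2) := by
    have := ((hsq.add hsq').div_const 2).mul_left M
    simpa using this
  refine hasSum_le (fun j => ?_) hF hG
  have e1 : (ω * (conj (x j) * x (j + 1) + b j * x j * conj (x (j + 1)))).re
      = ((ω + conj (ω * b j)) * (conj (x j) * x (j + 1))).re := by
    simp only [Complex.mul_re, Complex.mul_im, Complex.add_re, Complex.add_im, Complex.conj_re,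
      Complex.conj_im]
    ring
  rw [e1]
  refine (Complex.re_le_norm _).trans ?_
  rw [norm_mul, norm_mul, RCLike.norm_conj]
  have hM0 : 0 ≤ M := (norm_nonneg _).trans (hM j)
  refine mul_le_mul (hM j) ?_ (by positivity) hM0
  nlinarith [sq_nonneg (‖x j‖ - ‖x (j + 1)‖)]

lemma aux_single (b : ℤ → ℂ) (A : Hseq →L[ℂ] Hseq) (hA : IsTridiag b A) (k : ℤ) :
    A (lp.single 2 k (1 : ℂ)) = lp.single 2 (k - 1) (1 : ℂ) + b k • lp.single 2 (k + 1) (1 : ℂ) := by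
  ext j
  rw [hA]
  simp only [lp.coeFn_add, lp.coeFn_smul, Pi.add_apply, Pi.smul_apply, lp.single_apply,
    Pi.single_apply, smul_eq_mul]
  have h1 : (j + 1 = k) ↔ (j = k - 1) := by omega
  have h2 : (j - 1 = k) ↔ (j = k + 1) := by omega
  simp only [h1, h2]
  congr 1
  split_ifs with h
  · rw [h]; simp
  · simp

lemma aux_window (𝒜 : Finset ℂ) (b : ℤ → ℂ) (hb : ∀ i, b i ∈ 𝒜) (a : ℂ)
    (ha : (fun _ : ℤ => a) ∈ closure (shiftOrbit b)) (N : ℕ) :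
    ∃ m : ℤ, ∀ k : ℕ, k ≤ N → b (m + k) = a := by
  have hU : IsOpen (((𝒜.erase a : Finset ℂ) : Set ℂ)ᶜ) :=
    (Finset.finite_toSet _).isClosed.isOpen_compl
  have hopen : IsOpen (Set.pi ((Finset.range (N + 1)).image (fun k : ℕ => (k : ℤ)) : Set ℤ)
      (fun _ => (((𝒜.erase a : Finset ℂ) : Set ℂ)ᶜ))) :=
    isOpen_set_pi (Finset.finite_toSet _) fun _ _ => hU
  obtain ⟨c, hc, n, rfl⟩ := mem_closure_iff.mp ha _ hopen (by intro i _; simp)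
  refine ⟨n, fun k hk => ?_⟩
  have := hc (k : ℤ) (by simp; omega)
  by_contra hne
  apply this
  simp only [Finset.coe_erase, Set.mem_sdiff, Finset.mem_coe, Set.mem_singleton_iff]
  rw [add_comm]
  exact ⟨hb _, hne⟩

lemma aux_telescope (b : ℤ → ℂ) (A : Hseq →L[ℂ] Hseq) (hA : IsTridiag b A) (a u : ℂ)
    (hu : u ≠ 0) (m : ℤ) (N : ℕ) (hm : ∀ k : ℕ, k ≤ N → b (m + k) = a) :
    A (∑ k ∈ Finset.range (N + 1), u ^ k • lp.single 2 (m + k) (1 : ℂ)) -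
      (u + a * u⁻¹) • (∑ k ∈ Finset.range (N + 1), u ^ k • (lp.single 2 (m + k) (1 : ℂ) : Hseq)) =
    lp.single 2 (m - 1) (1 : ℂ) - (a * u⁻¹) • lp.single 2 m (1 : ℂ)
      - u ^ (N + 1) • lp.single 2 (m + N) (1 : ℂ)
      + (a * u ^ N) • lp.single 2 (m + N + 1) (1 : ℂ) := by
  induction N with
  | zero =>
    have h0 := hm 0 le_rfl
    simp only [Nat.cast_zero, add_zero] at h0
    simp [aux_single b A hA, h0]
    module
  | succ N ih =>
    have ih := ih fun k hk => hm k (by omega)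
    rw [Finset.sum_range_succ, map_add, map_smul, aux_single b A hA, hm _ le_rfl, smul_add (u + a * u⁻¹),
      add_sub_add_comm, ih]
    have e : m + ((N + 1 : ℕ) : ℤ) - 1 = m + N := by push_cast; ring
    have e2 : m + (N : ℤ) + 1 = m + ((N + 1 : ℕ) : ℤ) := by push_cast; ring
    rw [e, e2]
    match_scalars <;> field_simp <;> ring

lemma aux_mem_spectrum (𝒜 : Finset ℂ) (b : ℤ → ℂ) (hb : ∀ i, b i ∈ 𝒜) (a : ℂ)
    (ha : (fun _ : ℤ => a) ∈ closure (shiftOrbit b))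
    (A : Hseq →L[ℂ] Hseq) (hA : IsTridiag b A) (u : ℂ) (hu : ‖u‖ = 1) :
    u + a * u⁻¹ ∈ spectrum ℂ A := by
  have hu0 : u ≠ 0 := by intro h; simp [h] at hu
  rw [spectrum.mem_iff]
  intro hunit
  obtain ⟨T, hT⟩ := hunit.exists_left_inv
  have hbound : ∀ x : Hseq, ‖x‖ ≤ ‖T‖ * ‖A x - (u + a * u⁻¹) • x‖ := by
    intro x
    have h1 : T ((algebraMap ℂ (Hseq →L[ℂ] Hseq) (u + a * u⁻¹) - A) x) = x := by
      have := congrArg (fun S : Hseq →L[ℂ] Hseq => S x) hT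
      simpa only [mul_apply_eq_comp, one_apply_eq_self] using this
    have h2 : (algebraMap ℂ (Hseq →L[ℂ] Hseq) (u + a * u⁻¹) - A) x
        = -(A x - (u + a * u⁻¹) • x) := by
      simp [Algebra.algebraMap_eq_smul_one]
    calc ‖x‖ = ‖T ((algebraMap ℂ (Hseq →L[ℂ] Hseq) (u + a * u⁻¹) - A) x)‖ := by rw [h1]
      _ ≤ _ := T.le_opNorm _
      _ = _ := by rw [h2, norm_neg]
  have hs1 : ∀ k : ℤ, ‖(lp.single 2 k (1 : ℂ) : Hseq)‖ = 1 := fun k => by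
    rw [lp.norm_single (by norm_num)]; simp
  set K : ℝ := ‖T‖ * (2 + 2 * ‖a‖) with hK
  have hK0 : 0 ≤ K := by positivity
  obtain ⟨N, hN⟩ := exists_nat_gt (K ^ 2)
  obtain ⟨m, hm⟩ := aux_window 𝒜 b hb a ha N
  have htel := aux_telescope b A hA a u hu0 m N hm
  set x : Hseq := ∑ k ∈ Finset.range (N + 1), u ^ k • lp.single 2 (m + k) (1 : ℂ) with hx
  have hnx : ‖x‖ ^ 2 = N + 1 := by
    have h1 := lp.norm_sum_single (E := fun _ : ℤ => ℂ) (p := 2) (by norm_num)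
      (fun i => u ^ (i - m)) ((Finset.range (N + 1)).image (fun k : ℕ => m + (k : ℤ)))
    have hinj : Function.Injective (fun k : ℕ => m + (k : ℤ)) := by
      intro i j h; simpa using h
    rw [Finset.sum_image hinj.injOn, Finset.sum_image hinj.injOn] at h1
    have h2 : x = ∑ k ∈ Finset.range (N + 1),
        (lp.single 2 (m + (k : ℤ)) (u ^ (m + (k : ℤ) - m)) : Hseq) := by
      rw [hx]
      refine Finset.sum_congr rfl fun k _ => ?_
      rw [← lp.single_smul]
      simp
    rw [← h2] at h1
    simpa [hu] using h1
  have hle := hbound x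
  rw [htel] at hle
  have hres : ‖(lp.single 2 (m - 1) (1 : ℂ) - (a * u⁻¹) • lp.single 2 m (1 : ℂ)
      - u ^ (N + 1) • lp.single 2 (m + N) (1 : ℂ)
      + (a * u ^ N) • lp.single 2 (m + N + 1) (1 : ℂ) : Hseq)‖ ≤ 2 + 2 * ‖a‖ := by
    refine (norm_add_le _ _).trans ?_
    have h1 := norm_sub_le ((lp.single 2 (m - 1) (1 : ℂ) : Hseq) - (a * u⁻¹) • lp.single 2 m (1 : ℂ))
      (u ^ (N + 1) • lp.single 2 (m + N) (1 : ℂ))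
    have h2 := norm_sub_le (lp.single 2 (m - 1) (1 : ℂ) : Hseq) ((a * u⁻¹) • lp.single 2 m (1 : ℂ))
    have h3 : ‖(a * u⁻¹) • (lp.single 2 m (1 : ℂ) : Hseq)‖ = ‖a‖ := by
      rw [norm_smul, hs1]; simp [hu]
    have h4 : ‖u ^ (N + 1) • (lp.single 2 (m + N) (1 : ℂ) : Hseq)‖ = 1 := by
      rw [norm_smul, hs1]; simp [hu]
    have h5 : ‖(a * u ^ N) • (lp.single 2 (m + N + 1) (1 : ℂ) : Hseq)‖ = ‖a‖ := by
      rw [norm_smul, hs1]; simp [hu]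
    rw [h3, hs1] at h2
    rw [h4] at h1
    rw [h5]
    linarith
  have h6 : ‖x‖ ≤ K := hle.trans (mul_le_mul_of_nonneg_left hres (norm_nonneg _))
  have h7 : ‖x‖ ^ 2 ≤ K ^ 2 := pow_le_pow_left₀ (norm_nonneg _) h6 2
  linarith

/-- If every constant sequence `𝔞`, `𝔞 ∈ 𝒜`, belongs to `X_b`, then
`closure (W(A_b)) = conv (σ(A_b))`. -/
theorem stmt15 (𝒜 : Finset ℂ) (b : ℤ → ℂ) (hb : ∀ i, b i ∈ 𝒜)
    (hconst : ∀ a ∈ 𝒜, (fun _ : ℤ => a) ∈ closure (shiftOrbit b))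
    (Ab : Hseq →L[ℂ] Hseq) (hAb : IsTridiag b Ab) :
    closure (numRange Ab) = convexHull ℝ (spectrum ℂ Ab) := by
  have hne : 𝒜.Nonempty := ⟨b 0, hb 0⟩
  have hclosed : IsClosed (convexHull ℝ (spectrum ℂ Ab)) :=
    (aux_isCompact_convexHull (spectrum.isCompact Ab)).isClosed
  apply Set.Subset.antisymm
  · refine closure_minimal ?_ hclosed
    rintro z ⟨x, hx, rfl⟩
    by_contra hnot
    obtain ⟨f, s, hfs, hsf⟩ := RCLike.geometric_hahn_banach_closed_point (𝕜 := ℂ)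
      (convex_convexHull ℝ (spectrum ℂ Ab)) hclosed hnot
    have hf : ∀ w, f w = f 1 * w := by
      intro w
      have := f.map_smul w 1
      simp only [smul_eq_mul, mul_one] at this
      rw [this, mul_comm]
    set ω := f 1 with hω
    obtain ⟨a, ha, hmax⟩ := 𝒜.exists_max_image (fun a => ‖ω + conj (ω * a)‖) hne
    obtain ⟨a', ha', hmax'⟩ := 𝒜.exists_max_image (fun a => ‖a‖) hne
    have hbd := aux_bound b Ab hAb ω _ (fun i => hmax _ (hb i)) _ (fun i => hmax' _ (hb i)) x
    rw [hx] at hbd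
    obtain ⟨u, hu, hcu⟩ := aux_phase (ω + conj (ω * a))
    have hmem := aux_mem_spectrum 𝒜 b hb a (hconst a ha) Ab hAb u hu
    have h1 := hfs _ (subset_convexHull ℝ _ hmem)
    rw [hf] at h1 hsf
    have h2 : (ω * (u + a * u⁻¹)).re = ‖ω + conj (ω * a)‖ := by
      have h3 := congrArg Complex.re hcu
      rw [Complex.ofReal_re] at h3
      rw [← h3, Complex.inv_eq_conj hu]
      simp only [Complex.mul_re, Complex.mul_im, Complex.add_re, Complex.add_im, Complex.conj_re,
        Complex.conj_im]
      ring
    simp only [RCLike.re_eq_complex_re] at h1 hsf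
    rw [h2] at h1
    linarith
  · exact convexHull_min (aux_spectrum_subset Ab) (aux_convex Ab).closure
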